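/- Let X be a real Banach space, γ ∈ (0,1), T > 0, and σ with 3 - 2γ < σ < 4 - 2γ. There exists a constant C, depending only on γ, σ and T, with the following property. Let K ∈ ℕ, K ≥ 1, τ = T/K, t_k = kτ, a_j = (j+1)^{1-γ} - j^{1-γ}, and let A ≥ 0. Let u : [0,T] → X be continuous, twice continuously differentiable on (0,T], and satisfy: (i) ‖u'(t) - t^{-1}(u(t) - u(0))‖_X ≤ A t^{γ-1} for all t ∈ (0,T]; (ii) ∫_0^T t^σ ‖u''(t)‖_X^2 dt ≤ A^2; (iii) ‖u'(t)‖_X ≤ A t^{γ-1} for all t ∈ (0,T]. For 0 ≤ k ≤ K-1 define the consistency residual ρ^{k+1} = ∂_t^γ u(t_{k+1}) - (Γ(2-γ) τ^γ)^{-1} Σ_{j=0}^{k} a_j (u(t_{k+1-j}) - u(t_{k-j})), where ∂_t^γ u(t) = (1/Γ(1-γ)) ∫_0^t (t-r)^{-γ} u'(r) dr. Then τ Σ_{k=1}^{K} ‖ρ^k‖_X^2 ≤ C τ^{4-2γ-σ} A^2; in particular, writing θ = 2 - γ - σ/2 ∈ (0, 1/2), the residual satisfies ( τ Σ_{k=1}^{K}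 ‖ρ^k‖_X^2 )^{1/2} ≤ C^{1/2} τ^{θ} A. -/

import Mathlib

open MeasureTheory Real Set

lemma sum_sq_conv_le (v d : ℕ → ℝ) (hv : ∀ j, 0 ≤ v j) (K : ℕ) (V : ℝ)
    (hV : ∑ j ∈ Finset.range K, v j ≤ V) :
    ∑ k ∈ Finset.range K, (∑ i ∈ Finset.range (k + 1), v (k - i) * d i) ^ 2
      ≤ V ^ 2 * ∑ i ∈ Finset.range K, d i ^ 2 := by
  have hV0 : 0 ≤ V := (Finset.sum_nonneg fun j _ => hv j).trans hV
  have h1 : ∀ k ∈ Finset.range K, (∑ i ∈ Finset.range (k + 1), v (k - i) * d i) ^ 2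
      ≤ V * ∑ i ∈ Finset.range (k + 1), v (k - i) * d i ^ 2 := by
    intro k hk
    refine (Finset.sum_sq_le_sum_mul_sum_of_sq_le_mul _ (f := fun i => v (k - i))
      (g := fun i => v (k - i) * d i ^ 2) (fun i _ => hv _)
      (fun i _ => mul_nonneg (hv _) (sq_nonneg _)) (fun i _ => le_of_eq (by ring))).trans ?_
    refine mul_le_mul_of_nonneg_right ?_
      (Finset.sum_nonneg fun i _ => mul_nonneg (hv _) (sq_nonneg _))
    have h := Finset.sum_range_reflect v (k + 1)
    simp only [Nat.add_sub_cancel] at h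
    rw [h]
    exact (Finset.sum_le_sum_of_subset_of_nonneg
      (Finset.range_mono (Finset.mem_range.1 hk)) fun _ _ _ => hv _).trans hV
  refine (Finset.sum_le_sum h1).trans ?_
  rw [← Finset.mul_sum, pow_two, mul_assoc]
  refine mul_le_mul_of_nonneg_left ?_ hV0
  rw [Finset.sum_comm' (t' := Finset.range K) (s' := fun i => Finset.Ico i K)
    (by intro x y; simp only [Finset.mem_range, Finset.mem_Ico]; omega), Finset.mul_sum]
  refine Finset.sum_le_sum fun i _ => ?_
  rw [← Finset.sum_mul]
  refine mul_le_mul_of_nonneg_right ?_ (sq_nonneg _)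
  rw [Finset.sum_Ico_eq_sum_range]
  simp only [Nat.add_sub_cancel_left]
  exact (Finset.sum_le_sum_of_subset_of_nonneg
    (Finset.range_mono (Nat.sub_le _ _)) fun _ _ _ => hv _).trans hV

lemma rpow_mul_rpow_le_add {γ t r : ℝ} (hγ0 : 0 < γ) (hγ1 : γ < 1) (hr : 0 < r) (hrt : r ≤ t) :
    (t - r) ^ (-γ) * r ^ (γ - 1)
      ≤ (t / 2) ^ (-γ) * r ^ (γ - 1) + (t / 2) ^ (γ - 1) * (t - r) ^ (-γ) := by
  have ht : 0 < t := hr.trans_le hrt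
  have h1 : 0 ≤ (t - r) ^ (-γ) := rpow_nonneg (by linarith) _
  have h2 : 0 ≤ r ^ (γ - 1) := rpow_nonneg hr.le _
  have h3 : 0 ≤ (t / 2) ^ (-γ) := rpow_nonneg (by linarith) _
  have h4 : 0 ≤ (t / 2) ^ (γ - 1) := rpow_nonneg (by linarith) _
  rcases le_total (t / 2) r with h | h
  · have := rpow_le_rpow_of_nonpos (z := γ - 1) (by positivity : 0 < t / 2) h (by linarith)
    nlinarith [mul_nonneg h3 h2, mul_le_mul_of_nonneg_left this h1]
  · have := rpow_le_rpow_of_nonpos (z := -γ) (by positivity : 0 < t / 2)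
      (by linarith : t / 2 ≤ t - r) (by linarith)
    nlinarith [mul_nonneg h4 h1, mul_le_mul_of_nonneg_right this h2]

lemma intervalIntegrable_sub_rpow {γ : ℝ} (hγ1 : γ < 1) (t a b : ℝ) :
    IntervalIntegrable (fun r => (t - r) ^ (-γ)) volume a b := by
  have := (intervalIntegral.intervalIntegrable_rpow' (a := t - a) (b := t - b)
    (show -1 < -γ by linarith)).comp_sub_left t
  simpa using this

lemma integral_sub_rpow {γ : ℝ} (hγ1 : γ < 1) (t a b : ℝ) :
    ∫ r in a..b, (t - r) ^ (-γ) = ((t - a) ^ (1 - γ) - (t - b) ^ (1 - γ)) / (1 - γ) := by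
  rw [intervalIntegral.integral_comp_sub_left (fun x => x ^ (-γ)) t,
    integral_rpow (Or.inl (by linarith))]
  ring_nf

lemma integral_rpow_sub_one {γ : ℝ} (hγ0 : 0 < γ) (t : ℝ) :
    ∫ r in (0 : ℝ)..t, r ^ (γ - 1) = t ^ γ / γ := by
  rw [integral_rpow (Or.inl (by linarith)), sub_add_cancel, zero_rpow hγ0.ne', sub_zero]

lemma sq_integral_le {f : ℝ → ℝ} {a b σ : ℝ} (ha : 0 < a) (hab : a < b) (hσ : 0 ≤ σ)
    (hf : ContinuousOn f (Icc a b)) :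
    (∫ t in a..b, f t) ^ 2 ≤ (b - a) * a ^ (-σ) * ∫ t in a..b, t ^ σ * f t ^ 2 := by
  have hL : 0 < b - a := sub_pos.2 hab
  have hf1 : IntervalIntegrable f volume a b := hf.intervalIntegrable_of_Icc hab.le
  have hf2 : IntervalIntegrable (fun t => f t ^ 2) volume a b :=
    (hf.pow 2).intervalIntegrable_of_Icc hab.le
  have hf3 : IntervalIntegrable (fun t => t ^ σ * f t ^ 2) volume a b :=
    ((continuousOn_id.rpow_const fun x _ => Or.inr hσ).mul (hf.pow 2)).intervalIntegrable_of_Icc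
      hab.le
  have h1 : (∫ t in a..b, f t) ^ 2 ≤ (b - a) * ∫ t in a..b, f t ^ 2 := by
    set I := ∫ t in a..b, f t
    have h0 : 0 ≤ ∫ t in a..b, (f t - I / (b - a)) ^ 2 :=
      intervalIntegral.integral_nonneg hab.le fun t _ => sq_nonneg _
    have h : ∫ t in a..b, (f t - I / (b - a)) ^ 2
        = (∫ t in a..b, f t ^ 2) - 2 * (I / (b - a)) * I + (b - a) * (I / (b - a)) ^ 2 := by
      have : ∀ t, (f t - I / (b - a)) ^ 2
          = f t ^ 2 - 2 * (I / (b - a)) * f t + (I / (b - a)) ^ 2 := fun t => by ring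
      simp only [this]
      rw [intervalIntegral.integral_add (hf2.sub (hf1.const_mul _)) (by simp),
        intervalIntegral.integral_sub hf2 (hf1.const_mul _),
        intervalIntegral.integral_const_mul, intervalIntegral.integral_const, smul_eq_mul]
    rw [h] at h0
    have h' := mul_nonneg hL.le h0
    have : (b - a) * ((∫ t in a..b, f t ^ 2) - 2 * (I / (b - a)) * I
        + (b - a) * (I / (b - a)) ^ 2) = (b - a) * (∫ t in a..b, f t ^ 2) - I ^ 2 := by
      field_simp; ring
    linarith
  have h2 : ∫ t in a..b, f t ^ 2 ≤ a ^ (-σ) * ∫ t in a..b, t ^ σ * f t ^ 2 := by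
    rw [← intervalIntegral.integral_const_mul]
    refine intervalIntegral.integral_mono_on hab.le hf2 (hf3.const_mul _) fun t ht => ?_
    have : 1 ≤ a ^ (-σ) * t ^ σ := by
      rw [rpow_neg ha.le, ← div_eq_inv_mul, one_le_div (rpow_pos_of_pos ha _)]
      exact rpow_le_rpow ha.le ht.1 hσ
    nlinarith [sq_nonneg (f t)]
  rw [mul_assoc]
  exact h1.trans (mul_le_mul_of_nonneg_left h2 hL.le)

section
variable {X : Type*} [NormedAddCommGroup X] [NormedSpace ℝ X]

lemma norm_integral_smul_le_of_integral_eq_zero [CompleteSpace X] {φ : ℝ → ℝ} {e : ℝ → X}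
    {a b c V : ℝ} (hab : a ≤ b)
    (he : IntervalIntegrable e volume a b)
    (hφe : IntervalIntegrable (fun r => φ r • e r) volume a b)
    (h0 : ∫ r in a..b, e r = 0) (hV : ∀ r ∈ Ioc a b, |φ r - c| ≤ V) :
    ‖∫ r in a..b, φ r • e r‖ ≤ V * ∫ r in a..b, ‖e r‖ := by
  have h : ∫ r in a..b, φ r • e r = ∫ r in a..b, (φ r - c) • e r := by
    simp only [sub_smul]
    have hce : IntervalIntegrable (fun r => c • e r) volume a b := he.smul c
    rw [intervalIntegral.integral_sub hφe hce, intervalIntegral.integral_smul, h0]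
    simp
  rw [h, ← intervalIntegral.integral_const_mul]
  refine intervalIntegral.norm_integral_le_of_norm_le hab ?_ (he.norm.const_mul V)
  refine Filter.Eventually.of_forall fun r hr => ?_
  rw [norm_smul, Real.norm_eq_abs]
  exact mul_le_mul_of_nonneg_right (hV r hr) (norm_nonneg _)

lemma intervalIntegrable_smul_of_norm_le {f : ℝ → X} {γ A t : ℝ} (hγ0 : 0 < γ) (hγ1 : γ < 1)
    (ht : 0 < t) (hA : 0 ≤ A) (hc : ContinuousOn f (Ioc 0 t))
    (hf : ∀ r ∈ Ioc 0 t, ‖f r‖ ≤ A * r ^ (γ - 1)) :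
    IntervalIntegrable (fun r => (t - r) ^ (-γ) • f r) volume 0 t ∧
      ‖∫ r in (0 : ℝ)..t, (t - r) ^ (-γ) • f r‖ ≤ A * (2 / (γ * (1 - γ))) := by
  have hb : ∀ r ∈ Ioc 0 t, ‖(t - r) ^ (-γ) • f r‖ ≤
      A * ((t / 2) ^ (-γ) * r ^ (γ - 1) + (t / 2) ^ (γ - 1) * (t - r) ^ (-γ)) := by
    intro r hr
    have h0 : 0 ≤ (t - r) ^ (-γ) := rpow_nonneg (by linarith [hr.2]) _
    rw [norm_smul, Real.norm_of_nonneg h0]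
    calc _ ≤ (t - r) ^ (-γ) * (A * r ^ (γ - 1)) := mul_le_mul_of_nonneg_left (hf r hr) h0
      _ = A * ((t - r) ^ (-γ) * r ^ (γ - 1)) := by ring
      _ ≤ _ := mul_le_mul_of_nonneg_left (rpow_mul_rpow_le_add hγ0 hγ1 hr.1 hr.2) hA
  have i1 : IntervalIntegrable (fun r : ℝ => r ^ (γ - 1)) volume 0 t :=
    intervalIntegral.intervalIntegrable_rpow' (by linarith)
  have i2 := intervalIntegrable_sub_rpow hγ1 t 0 t
  have hi := ((i1.const_mul ((t / 2) ^ (-γ))).add (i2.const_mul ((t / 2) ^ (γ - 1)))).const_mul A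
  refine ⟨?_, ?_⟩
  · rw [intervalIntegrable_iff_integrableOn_Ioc_of_le ht.le] at hi ⊢
    refine hi.mono' ?_ ((ae_restrict_iff' measurableSet_Ioc).2 (Filter.Eventually.of_forall hb))
    refine AEStronglyMeasurable.smul ?_ (hc.aestronglyMeasurable measurableSet_Ioc)
    exact (by fun_prop : Measurable fun r : ℝ => (t - r) ^ (-γ)).aestronglyMeasurable
  · refine (intervalIntegral.norm_integral_le_of_norm_le ht.le
      (Filter.Eventually.of_forall hb) hi).trans (le_of_eq_of_le
        (intervalIntegral.integral_const_mul _ _) (mul_le_mul_of_nonneg_left ?_ hA))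
    rw [intervalIntegral.integral_add (i1.const_mul _) (i2.const_mul _),
      intervalIntegral.integral_const_mul, intervalIntegral.integral_const_mul,
      integral_rpow_sub_one hγ0, integral_sub_rpow hγ1, sub_self, sub_zero,
      zero_rpow (by linarith), sub_zero, div_rpow ht.le zero_le_two, div_rpow ht.le zero_le_two]
    have e1 : t ^ (-γ) * t ^ γ = 1 := by rw [← rpow_add ht]; simp
    have e2 : t ^ (γ - 1) * t ^ (1 - γ) = 1 := by rw [← rpow_add ht]; simp
    have e3 : ((2 : ℝ) ^ (-γ))⁻¹ ≤ 2 := by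
      rw [← rpow_neg zero_le_two, neg_neg]
      exact (rpow_le_rpow_of_exponent_le one_le_two hγ1.le).trans (by simp)
    have e4 : ((2 : ℝ) ^ (γ - 1))⁻¹ ≤ 2 := by
      rw [← rpow_neg zero_le_two]
      exact (rpow_le_rpow_of_exponent_le one_le_two (by linarith : -(γ - 1) ≤ 1)).trans (by simp)
    have hγ' : 0 < 1 - γ := by linarith
    calc _ = (t ^ (-γ) * t ^ γ) * ((2 : ℝ) ^ (-γ))⁻¹ / γ
          + (t ^ (γ - 1) * t ^ (1 - γ)) * ((2 : ℝ) ^ (γ - 1))⁻¹ / (1 - γ) := by ring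
      _ ≤ 2 / γ + 2 / (1 - γ) := by
        rw [e1, e2, one_mul, one_mul]; gcongr
      _ = _ := by field_simp; ring
lemma norm_deriv_sub_slope_le [CompleteSpace X] {u u' u'' : ℝ → X} {a b : ℝ} (hab : a < b)
    (hu : ∀ t ∈ Icc a b, HasDerivAt u (u' t) t)
    (hu' : ∀ t ∈ Icc a b, HasDerivAt u' (u'' t) t)
    (hc : ContinuousOn u'' (Icc a b)) {r : ℝ} (hr : r ∈ Icc a b) :
    ‖u' r - (b - a)⁻¹ • (u b - u a)‖ ≤ ∫ t in a..b, ‖u'' t‖ := by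
  have hD0 : 0 ≤ ∫ t in a..b, ‖u'' t‖ :=
    intervalIntegral.integral_nonneg hab.le fun t _ => norm_nonneg _
  have h1 : ∀ s ∈ Icc a b, ‖u' s - u' r‖ ≤ ∫ t in a..b, ‖u'' t‖ := by
    intro s hs
    have hsub : uIcc r s ⊆ Icc a b := uIcc_subset_Icc hr hs
    rw [← intervalIntegral.integral_eq_sub_of_hasDerivAt (fun t ht => hu' t (hsub ht))
      (hc.mono hsub).intervalIntegrable]
    refine intervalIntegral.norm_integral_le_abs_integral_norm.trans ?_
    rw [← abs_of_nonneg hD0]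
    refine intervalIntegral.abs_integral_mono_interval ?_
      (Filter.Eventually.of_forall fun t => norm_nonneg _)
      (hc.norm.intervalIntegrable_of_Icc hab.le)
    rw [uIoc_of_le hab.le]
    exact Ioc_subset_Ioc (le_min hr.1 hs.1) (max_le hr.2 hs.2)
  have h2 := (convex_Icc a b).norm_image_sub_le_of_norm_hasDerivWithin_le
    (f := fun s => u s - s • u' r) (f' := fun s => u' s - (1 : ℝ) • u' r)
    (fun s hs => ((hu s hs).sub ((hasDerivAt_id s).smul_const (u' r))).hasDerivWithinAt)
    (C := ∫ t in a..b, ‖u'' t‖) (fun s hs => by simpa using h1 s hs)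
    (left_mem_Icc.2 hab.le) (right_mem_Icc.2 hab.le)
  have hL : 0 < b - a := sub_pos.2 hab
  have h3 : u' r - (b - a)⁻¹ • (u b - u a)
      = -((b - a)⁻¹ • ((u b - b • u' r) - (u a - a • u' r))) := by
    have : (u b - b • u' r) - (u a - a • u' r) = (u b - u a) - (b - a) • u' r := by module
    rw [this, smul_sub _ (u b - u a), smul_smul, inv_mul_cancel₀ hL.ne']
    module
  rw [h3, norm_neg, norm_smul, Real.norm_of_nonneg (inv_nonneg.2 hL.le), inv_mul_le_iff₀ hL,
    mul_comm]
  simpa [abs_of_pos hL] using h2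

/-- Convolution weights dominating the local contributions to the consistency error. -/
noncomputable def consistencyWeight (γ : ℝ) (j : ℕ) : ℝ :=
  if j = 0 then 1 / (1 - γ) else (j : ℝ) ^ (-γ) - ((j : ℝ) + 1) ^ (-γ)

lemma consistencyWeight_nonneg {γ : ℝ} (hγ0 : 0 < γ) (hγ1 : γ < 1) (j : ℕ) :
    0 ≤ consistencyWeight γ j := by
  unfold consistencyWeight
  split_ifs with h
  · exact one_div_nonneg.2 (by linarith)
  · exact sub_nonneg.2 (rpow_le_rpow_of_nonpos (by positivity) (by linarith) (by linarith))

lemma sum_consistencyWeight_le {γ : ℝ} (hγ1 : γ < 1) (K : ℕ) :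
    ∑ j ∈ Finset.range K, consistencyWeight γ j ≤ 1 / (1 - γ) + 1 := by
  have hγ' : 0 ≤ 1 / (1 - γ) := one_div_nonneg.2 (by linarith)
  have h : ∀ n : ℕ, ∑ j ∈ Finset.range (n + 1), consistencyWeight γ j
      = 1 / (1 - γ) + 1 - ((n : ℝ) + 1) ^ (-γ) := by
    intro n
    induction n with
    | zero => simp [consistencyWeight]
    | succ n ih =>
      rw [Finset.sum_range_succ, ih, consistencyWeight, if_neg n.succ_ne_zero]
      push_cast
      ring
  rcases K with _ | n
  · simpa using add_nonneg hγ' zero_le_one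
  · rw [h]
    linarith [rpow_nonneg (by positivity : (0 : ℝ) ≤ (n : ℝ) + 1) (-γ)]

lemma abs_sub_rpow_sub_le {γ τ r : ℝ} {i k : ℕ} (hγ0 : 0 < γ) (hτ : 0 < τ) (hik : i < k)
    (hr : r ∈ Icc ((i : ℝ) * τ) (((i : ℝ) + 1) * τ)) :
    |(((k : ℝ) + 1) * τ - r) ^ (-γ) - (((k : ℝ) + 1) * τ - i * τ) ^ (-γ)|
      ≤ τ ^ (-γ) * consistencyWeight γ (k - i) := by
  have hki : (i : ℝ) + 1 ≤ k := by exact_mod_cast hik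
  have hpos : 0 < ((k : ℝ) - i) * τ := mul_pos (by linarith) hτ
  rw [consistencyWeight, if_neg (by omega), Nat.cast_sub hik.le, mul_sub,
    ← mul_rpow hτ.le (by linarith), ← mul_rpow hτ.le (by linarith)]
  have e1 : τ * ((k : ℝ) - i + 1) = ((k : ℝ) + 1) * τ - i * τ := by ring
  have e2 : τ * ((k : ℝ) - i) = ((k : ℝ) - i) * τ := by ring
  rw [e1, e2]
  have h1 : (((k : ℝ) + 1) * τ - r) ^ (-γ) ≤ (((k : ℝ) - i) * τ) ^ (-γ) :=
    rpow_le_rpow_of_nonpos hpos (by linarith [hr.2]) (by linarith)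
  have h2 : (((k : ℝ) + 1) * τ - i * τ) ^ (-γ) ≤ (((k : ℝ) + 1) * τ - r) ^ (-γ) :=
    rpow_le_rpow_of_nonpos (by linarith [hr.2]) (by linarith [hr.1]) (by linarith)
  rw [abs_of_nonneg (by linarith)]
  linarith

/-- Bound on the oscillation of `u'` on the `i`-th time step, in terms of `u''` away from `0`. -/
noncomputable def stepOscillation {E : Type*} [NormedAddCommGroup E] (γ τ A : ℝ)
    (u'' : ℝ → E) (i : ℕ) : ℝ :=
  if i = 0 then 3 * A / γ * τ ^ (γ - 1) else ∫ t in (i : ℝ) * τ..((i : ℝ) + 1) * τ, ‖u'' t‖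

lemma intervalIntegrable_of_norm_le_rpow {E : Type*} [NormedAddCommGroup E] {f : ℝ → E}
    {γ A t : ℝ} (hγ0 : 0 < γ)
    (ht : 0 ≤ t) (hc : ContinuousOn f (Ioc 0 t))
    (hf : ∀ r ∈ Ioc 0 t, ‖f r‖ ≤ A * r ^ (γ - 1)) :
    IntervalIntegrable f volume 0 t ∧ ∫ r in (0 : ℝ)..t, ‖f r‖ ≤ A * (t ^ γ / γ) := by
  have hi : IntervalIntegrable (fun r : ℝ => A * r ^ (γ - 1)) volume 0 t :=
    (intervalIntegral.intervalIntegrable_rpow' (by linarith)).const_mul A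
  have hfi : IntervalIntegrable f volume 0 t := by
    rw [intervalIntegrable_iff_integrableOn_Ioc_of_le ht] at hi ⊢
    exact hi.mono' (hc.aestronglyMeasurable measurableSet_Ioc)
      ((ae_restrict_iff' measurableSet_Ioc).2 (Filter.Eventually.of_forall hf))
  refine ⟨hfi, ?_⟩
  rw [← integral_rpow_sub_one hγ0, ← intervalIntegral.integral_const_mul]
  refine intervalIntegral.integral_mono_ae_restrict ht hfi.norm hi ?_
  rw [← restrict_Ioc_eq_restrict_Icc]
  exact (ae_restrict_iff' measurableSet_Ioc).2 (Filter.Eventually.of_forall hf)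

lemma norm_integral_smul_sub_slope_le [CompleteSpace X] {u u' u'' : ℝ → X} {γ τ A : ℝ} {i k : ℕ}
    (hγ0 : 0 < γ) (hγ1 : γ < 1) (hτ : 0 < τ) (hA : 0 ≤ A) (hik : i ≤ k)
    (hu0 : ContinuousOn u (Icc 0 (((k : ℝ) + 1) * τ)))
    (hu : ∀ t ∈ Ioc 0 (((k : ℝ) + 1) * τ), HasDerivAt u (u' t) t)
    (hu' : ∀ t ∈ Ioc 0 (((k : ℝ) + 1) * τ), HasDerivAt u' (u'' t) t)
    (hc'' : ContinuousOn u'' (Ioc 0 (((k : ℝ) + 1) * τ)))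
    (hbd : ∀ t ∈ Ioc 0 (((k : ℝ) + 1) * τ), ‖u' t‖ ≤ A * t ^ (γ - 1)) :
    ‖∫ r in (i : ℝ) * τ..((i : ℝ) + 1) * τ, (((k : ℝ) + 1) * τ - r) ^ (-γ) •
        (u' r - τ⁻¹ • (u (((i : ℝ) + 1) * τ) - u ((i : ℝ) * τ)))‖
      ≤ τ ^ (1 - γ) * (consistencyWeight γ (k - i) * stepOscillation γ τ A u'' i) := by
  have hγ' : 0 < 1 - γ := by linarith
  set t : ℝ := ((k : ℝ) + 1) * τ with ht
  set a : ℝ := (i : ℝ) * τ with ha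
  set b : ℝ := ((i : ℝ) + 1) * τ with hb
  set δ : X := τ⁻¹ • (u b - u a) with hδ
  have hba : b - a = τ := by rw [ha, hb]; ring
  have hab : a < b := by linarith
  have ha0 : 0 ≤ a := by positivity
  have hbt : b ≤ t := by
    have : (i : ℝ) ≤ k := by exact_mod_cast hik
    rw [hb, ht]; gcongr
  have ht0 : 0 < t := by positivity
  have hc' : ContinuousOn u' (Ioc 0 t) := fun s hs => (hu' s hs).continuousAt.continuousWithinAt
  have hsub : uIcc a b ⊆ uIcc 0 t := by
    rw [uIcc_of_le hab.le, uIcc_of_le ht0.le]; exact Icc_subset_Icc ha0 hbt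
  have hu'i : IntervalIntegrable u' volume a b :=
    (intervalIntegrable_of_norm_le_rpow hγ0 ht0.le hc' hbd).1.mono_set hsub
  have hker := intervalIntegrable_sub_rpow hγ1 t a b
  have hku : IntervalIntegrable (fun r => (t - r) ^ (-γ) • u' r) volume a b :=
    (intervalIntegrable_smul_of_norm_le hγ0 hγ1 ht0 hA hc' hbd).1.mono_set hsub
  have hkδ : IntervalIntegrable (fun r => (t - r) ^ (-γ) • δ) volume a b :=
    ⟨hker.1.smul_const δ, hker.2.smul_const δ⟩
  have he : IntervalIntegrable (fun r => u' r - δ) volume a b := hu'i.sub (by simp)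
  have hke : IntervalIntegrable (fun r => (t - r) ^ (-γ) • (u' r - δ)) volume a b := by
    simpa only [smul_sub] using hku.sub hkδ
  have hftc : ∫ r in a..b, u' r = u b - u a :=
    intervalIntegral.integral_eq_sub_of_hasDerivAt_of_le hab.le
      (hu0.mono (Icc_subset_Icc ha0 hbt))
      (fun s hs => hu s ⟨ha0.trans_lt hs.1, hs.2.le.trans hbt⟩) hu'i
  have hτδ : τ • δ = u b - u a := smul_inv_smul₀ hτ.ne' _
  have he0 : ∫ r in a..b, (u' r - δ) = 0 := by
    rw [intervalIntegral.integral_sub hu'i (by simp), hftc, intervalIntegral.integral_const, hba,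
      hτδ, sub_self]
  have hw := consistencyWeight_nonneg hγ0 hγ1 (k - i)
  have hττ : τ ^ (1 - γ) = τ ^ (-γ) * τ := by
    rw [← rpow_add_one hτ.ne']; ring_nf
  have hτγ : τ ^ γ = τ * τ ^ (γ - 1) := by
    rw [mul_comm, ← rpow_add_one hτ.ne']; ring_nf
  have hcancel : i < k → ∫ r in a..b, ‖u' r - δ‖ ≤ τ * stepOscillation γ τ A u'' i →
      ‖∫ r in a..b, (t - r) ^ (-γ) • (u' r - δ)‖
        ≤ τ ^ (1 - γ) * (consistencyWeight γ (k - i) * stepOscillation γ τ A u'' i) := by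
    intro hlt hosc
    refine (norm_integral_smul_le_of_integral_eq_zero hab.le he hke he0 fun r hr =>
      abs_sub_rpow_sub_le hγ0 hτ hlt (Ioc_subset_Icc_self hr)).trans ?_
    refine (mul_le_mul_of_nonneg_left hosc (by positivity)).trans (le_of_eq ?_)
    rw [hττ]; ring
  rcases Nat.eq_zero_or_pos i with rfl | hi
  · have ea : a = 0 := by simp [ha]
    have eb : b = τ := by simp [hb]
    have hIn : ∫ r in a..b, ‖u' r‖ ≤ A * (τ ^ γ / γ) := by
      rw [ea, eb]
      have : Ioc 0 τ ⊆ Ioc 0 t := Ioc_subset_Ioc_right (eb ▸ hbt)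
      exact (intervalIntegrable_of_norm_le_rpow hγ0 hτ.le (hc'.mono this)
        fun r hr => hbd r (this hr)).2
    have hδn : τ * ‖δ‖ ≤ A * (τ ^ γ / γ) := by
      rw [← Real.norm_of_nonneg hτ.le, ← norm_smul, hτδ, ← hftc]
      rw [Real.norm_of_nonneg hτ.le]
      exact (intervalIntegral.norm_integral_le_integral_norm hab.le).trans hIn
    rcases Nat.eq_zero_or_pos k with rfl | hk
    · have et : t = τ := by simp [ht]
      have h1 := (intervalIntegrable_smul_of_norm_le hγ0 hγ1 ht0 hA hc' hbd).2
      have h2 : ∫ r in a..b, (t - r) ^ (-γ) • (u' r - δ)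
          = (∫ r in (0 : ℝ)..t, (t - r) ^ (-γ) • u' r) - (τ ^ (1 - γ) / (1 - γ)) • δ := by
        simp only [smul_sub]
        rw [intervalIntegral.integral_sub hku hkδ, intervalIntegral.integral_smul_const,
          integral_sub_rpow hγ1, ea, eb, et]
        simp [hγ'.ne']
      rw [h2]
      refine (norm_sub_le _ _).trans ?_
      rw [norm_smul, Real.norm_of_nonneg (by positivity)]
      have h3 : τ ^ (1 - γ) / (1 - γ) * ‖δ‖ ≤ A * (1 / (γ * (1 - γ))) := by
        have e : τ ^ (-γ) * τ ^ γ = 1 := by rw [← rpow_add hτ]; simp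
        calc _ = τ ^ (-γ) / (1 - γ) * (τ * ‖δ‖) := by rw [hττ]; ring
          _ ≤ τ ^ (-γ) / (1 - γ) * (A * (τ ^ γ / γ)) := by gcongr
          _ = (τ ^ (-γ) * τ ^ γ) * (A * (1 / (γ * (1 - γ)))) := by field_simp
          _ = _ := by rw [e, one_mul]
      have e : τ ^ (1 - γ) * τ ^ (γ - 1) = 1 := by rw [← rpow_add hτ]; simp
      have h4 : τ ^ (1 - γ) * (consistencyWeight γ (0 - 0) * stepOscillation γ τ A u'' 0)
          = A * (2 / (γ * (1 - γ))) + A * (1 / (γ * (1 - γ))) := by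
        simp only [consistencyWeight, stepOscillation, Nat.sub_self, if_true]
        calc _ = (τ ^ (1 - γ) * τ ^ (γ - 1)) * (3 * A / γ * (1 / (1 - γ))) := by ring
          _ = _ := by rw [e]; field_simp; ring
      rw [h4]
      exact add_le_add h1 h3
    · refine hcancel hk ?_
      calc _ ≤ ∫ r in a..b, (‖u' r‖ + ‖δ‖) :=
            intervalIntegral.integral_mono_on hab.le he.norm (hu'i.norm.add (by simp))
              fun r _ => norm_sub_le _ _
        _ = (∫ r in a..b, ‖u' r‖) + τ * ‖δ‖ := by
            rw [intervalIntegral.integral_add hu'i.norm (by simp),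
              intervalIntegral.integral_const, hba, smul_eq_mul]
        _ ≤ 2 * (A * (τ ^ γ / γ)) := by linarith
        _ ≤ 3 * (A * (τ ^ γ / γ)) := by gcongr; norm_num
        _ = _ := by
            simp only [stepOscillation, if_true]
            rw [hτγ]; ring
  · have ha0' : 0 < a := by positivity
    have hIcc : Icc a b ⊆ Ioc 0 t := fun s hs => ⟨ha0'.trans_le hs.1, hs.2.trans hbt⟩
    have hosc : ∀ r ∈ Icc a b, ‖u' r - δ‖ ≤ stepOscillation γ τ A u'' i := by
      intro r hr
      have h := norm_deriv_sub_slope_le hab (fun s hs => hu s (hIcc hs))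
        (fun s hs => hu' s (hIcc hs)) (hc''.mono hIcc) hr
      rw [hba] at h
      rwa [stepOscillation, if_neg hi.ne']
    rcases hik.lt_or_eq with hlt | rfl
    · refine hcancel hlt ?_
      calc _ ≤ ∫ r in a..b, stepOscillation γ τ A u'' i :=
            intervalIntegral.integral_mono_on hab.le he.norm (by simp) hosc
        _ = _ := by rw [intervalIntegral.integral_const, hba, smul_eq_mul]
    · refine (intervalIntegral.norm_integral_le_of_norm_le hab.le
        (g := fun r => (t - r) ^ (-γ) * stepOscillation γ τ A u'' i)
        (Filter.Eventually.of_forall fun r hr => ?_) (hker.mul_const _)).trans (le_of_eq ?_)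
      · have h0 : 0 ≤ (t - r) ^ (-γ) := rpow_nonneg (by linarith [hr.2]) _
        rw [norm_smul, Real.norm_of_nonneg h0]
        exact mul_le_mul_of_nonneg_left (hosc r (Ioc_subset_Icc_self hr)) h0
      · have etb : t = b := rfl
        rw [intervalIntegral.integral_mul_const, integral_sub_rpow hγ1, etb, hba, sub_self,
          zero_rpow hγ'.ne', sub_zero, Nat.sub_self, consistencyWeight, if_pos rfl]
        ring
lemma residual_eq_sum [CompleteSpace X] {u u' : ℝ → X} {γ τ A : ℝ} (k : ℕ)
    (hγ0 : 0 < γ) (hγ1 : γ < 1) (hτ : 0 < τ) (hA : 0 ≤ A)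
    (hc' : ContinuousOn u' (Ioc 0 (((k : ℝ) + 1) * τ)))
    (hbd : ∀ t ∈ Ioc 0 (((k : ℝ) + 1) * τ), ‖u' t‖ ≤ A * t ^ (γ - 1)) :
    (Real.Gamma (1 - γ))⁻¹ •
          (∫ r in (0 : ℝ)..(((k : ℝ) + 1) * τ), ((((k : ℝ) + 1) * τ - r) ^ (-γ)) • u' r)
        - (Real.Gamma (2 - γ) * τ ^ γ)⁻¹ •
            ∑ j ∈ Finset.range (k + 1),
              (((j : ℝ) + 1) ^ (1 - γ) - (j : ℝ) ^ (1 - γ)) •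
                (u (((k + 1 - j : ℕ) : ℝ) * τ) - u (((k - j : ℕ) : ℝ) * τ))
      = (Real.Gamma (1 - γ))⁻¹ • ∑ i ∈ Finset.range (k + 1),
          ∫ r in (i : ℝ) * τ..((i : ℝ) + 1) * τ, (((k : ℝ) + 1) * τ - r) ^ (-γ) •
            (u' r - τ⁻¹ • (u (((i : ℝ) + 1) * τ) - u ((i : ℝ) * τ))) := by
  have hγ' : 0 < 1 - γ := by linarith
  set t : ℝ := ((k : ℝ) + 1) * τ with ht
  have ht0 : 0 < t := by positivity
  have hint : ∀ i ∈ Finset.range (k + 1),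
      IntervalIntegrable (fun r => (t - r) ^ (-γ) • u' r) volume
        ((i : ℝ) * τ) (((i : ℝ) + 1) * τ) := by
    intro i hi
    refine (intervalIntegrable_smul_of_norm_le hγ0 hγ1 ht0 hA hc' hbd).1.mono_set ?_
    have : (i : ℝ) ≤ k := by exact_mod_cast Nat.lt_succ_iff.1 (Finset.mem_range.1 hi)
    rw [uIcc_of_le (by gcongr; linarith), uIcc_of_le ht0.le]
    exact Icc_subset_Icc (by positivity) (by rw [ht]; gcongr)
  have hsplit : ∫ r in (0 : ℝ)..t, (t - r) ^ (-γ) • u' r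
      = ∑ i ∈ Finset.range (k + 1), ∫ r in (i : ℝ) * τ..((i : ℝ) + 1) * τ,
          (t - r) ^ (-γ) • u' r := by
    have := intervalIntegral.sum_integral_adjacent_intervals (μ := volume)
      (f := fun r => (t - r) ^ (-γ) • u' r) (a := fun i : ℕ => (i : ℝ) * τ) (n := k + 1)
      (fun i hi => by simpa using hint i (Finset.mem_range.2 hi))
    simpa [ht] using this.symm
  have hΓ : Real.Gamma (2 - γ) = (1 - γ) * Real.Gamma (1 - γ) := by
    rw [← Real.Gamma_add_one hγ'.ne']; ring_nf
  rw [hΓ, ← Finset.sum_range_reflect (fun j : ℕ => (((j : ℝ) + 1) ^ (1 - γ) - (j : ℝ) ^ (1 - γ)) •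
    (u (((k + 1 - j : ℕ) : ℝ) * τ) - u (((k - j : ℕ) : ℝ) * τ))) (k + 1), hsplit,
    Finset.smul_sum, Finset.smul_sum,
    Finset.smul_sum, ← Finset.sum_sub_distrib]
  refine Finset.sum_congr rfl fun i hi => ?_
  have hik : i ≤ k := Nat.lt_succ_iff.1 (Finset.mem_range.1 hi)
  have hikR : (i : ℝ) ≤ k := by exact_mod_cast hik
  have hker := intervalIntegrable_sub_rpow hγ1 t ((i : ℝ) * τ) (((i : ℝ) + 1) * τ)
  have e1 : k + 1 - (k + 1 - 1 - i) = i + 1 := by omega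
  have e2 : k - (k + 1 - 1 - i) = i := by omega
  have e3 : k + 1 - 1 - i = k - i := by omega
  rw [e1, e2, e3, Nat.cast_sub hik, Nat.cast_add_one]
  simp only [smul_sub (_ ^ (-γ) : ℝ)]
  rw [intervalIntegral.integral_sub (hint i hi) ⟨hker.1.smul_const _, hker.2.smul_const _⟩,
    intervalIntegral.integral_smul_const, integral_sub_rpow hγ1, smul_sub (Gamma _)⁻¹,
    smul_smul, smul_smul,
    smul_smul]
  congr 2
  have f1 : t - (i : ℝ) * τ = ((k : ℝ) - i + 1) * τ := by rw [ht]; ring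
  have f2 : t - ((i : ℝ) + 1) * τ = ((k : ℝ) - i) * τ := by rw [ht]; ring
  have hττ : τ ^ (1 - γ) = τ * (τ ^ γ)⁻¹ := by
    rw [← rpow_neg hτ.le, mul_comm, ← rpow_add_one hτ.ne']; ring_nf
  have hG := (Real.Gamma_pos_of_pos hγ').ne'
  have hτγ := (rpow_pos_of_pos hτ γ).ne'
  rw [f1, f2, mul_rpow (by linarith) hτ.le, mul_rpow (by linarith) hτ.le, hττ]
  field_simp

end

lemma sum_sq_stepOscillation_le {E : Type*} [NormedAddCommGroup E] {γ τ σ A : ℝ} {K : ℕ}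
    {u'' : ℝ → E} (hτ : 0 < τ) (hσ : 0 ≤ σ) (hK : 1 ≤ K)
    (hc'' : ContinuousOn u'' (Ioc 0 (K * τ)))
    (hint : IntegrableOn (fun t => t ^ σ * ‖u'' t‖ ^ 2) (Ioc 0 (K * τ)))
    (hle : (∫ t in Ioc 0 (K * τ), t ^ σ * ‖u'' t‖ ^ 2) ≤ A ^ 2) :
    ∑ i ∈ Finset.range K, stepOscillation γ τ A u'' i ^ 2
      ≤ (3 * A / γ * τ ^ (γ - 1)) ^ 2 + τ * τ ^ (-σ) * A ^ 2 := by
  obtain ⟨n, rfl⟩ : ∃ n, K = n + 1 := ⟨K - 1, by omega⟩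
  rw [Finset.sum_range_succ', add_comm]
  have h0 : stepOscillation γ τ A u'' 0 = 3 * A / γ * τ ^ (γ - 1) := if_pos rfl
  rw [h0]
  refine add_le_add_right ?_ _
  have hKτ : 0 ≤ ((n + 1 : ℕ) : ℝ) * τ := by positivity
  have hI : IntervalIntegrable (fun t => t ^ σ * ‖u'' t‖ ^ 2) volume 0 (((n + 1 : ℕ) : ℝ) * τ) :=
    (intervalIntegrable_iff_integrableOn_Ioc_of_le hKτ).2 hint
  have hterm : ∀ i ∈ Finset.range n, stepOscillation γ τ A u'' (i + 1) ^ 2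
      ≤ τ * τ ^ (-σ) * ∫ t in ((i : ℝ) + 1) * τ..((i : ℝ) + 2) * τ, t ^ σ * ‖u'' t‖ ^ 2 := by
    intro i hi
    have hin : (i : ℝ) + 1 ≤ n := by exact_mod_cast Finset.mem_range.1 hi
    have ha : 0 < ((i : ℝ) + 1) * τ := by positivity
    have hab : ((i : ℝ) + 1) * τ < ((i : ℝ) + 2) * τ := by gcongr; linarith
    rw [stepOscillation, if_neg i.succ_ne_zero, Nat.cast_add_one]
    have e : (i : ℝ) + 1 + 1 = i + 2 := by ring
    rw [e]
    refine (sq_integral_le ha hab hσ (hc''.norm.mono fun s hs => ⟨ha.trans_le hs.1,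
      hs.2.trans ?_⟩)).trans ?_
    · push_cast
      exact mul_le_mul_of_nonneg_right (by linarith) hτ.le
    · have e' : ((i : ℝ) + 2) * τ - ((i : ℝ) + 1) * τ = τ := by ring
      rw [e']
      refine mul_le_mul_of_nonneg_right (mul_le_mul_of_nonneg_left ?_ hτ.le)
        (intervalIntegral.integral_nonneg hab.le fun t ht =>
          mul_nonneg (rpow_nonneg (ha.le.trans ht.1) _) (sq_nonneg _))
      exact rpow_le_rpow_of_nonpos hτ (by nlinarith [i.cast_nonneg (α := ℝ)]) (by linarith)
  refine (Finset.sum_le_sum hterm).trans ?_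
  rw [← Finset.mul_sum]
  refine mul_le_mul_of_nonneg_left ?_ (by positivity)
  have hsum := intervalIntegral.sum_integral_adjacent_intervals (μ := volume)
    (f := fun t => t ^ σ * ‖u'' t‖ ^ 2) (a := fun i : ℕ => ((i : ℝ) + 1) * τ) (n := n)
    (fun i hi => hI.mono_set (by
      have hin : (i : ℝ) + 1 ≤ n := by exact_mod_cast hi
      rw [uIcc_of_le (by push_cast; gcongr; linarith), uIcc_of_le hKτ]
      exact Icc_subset_Icc (by positivity) (by push_cast; gcongr)))
  have e : ∀ i : ℕ, ((i + 1 : ℕ) : ℝ) + 1 = i + 2 := fun i => by push_cast; ring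
  simp only [e] at hsum
  rw [hsum]
  refine le_trans ?_ hle
  rw [intervalIntegral.integral_of_le (by gcongr; simp)]
  refine setIntegral_mono_set hint ?_ ?_
  · exact (ae_restrict_iff' measurableSet_Ioc).2 (Filter.Eventually.of_forall fun t ht =>
      mul_nonneg (rpow_nonneg ht.1.le _) (sq_nonneg _))
  · exact (Ioc_subset_Ioc (by positivity) (by push_cast; rfl)).eventuallyLE

/-- Consistency estimate for the finite difference discretization of the Caputo
fractional derivative of order `γ ∈ (0,1)` under realistic time regularity. -/
theorem caputo_consistency_estimate
    {X : Type*} [NormedAddCommGroup X] [NormedSpace ℝ X] [CompleteSpace X]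
    (γ T σ : ℝ) (hγ : γ ∈ Set.Ioo (0 : ℝ) 1) (hT : 0 < T)
    (hσ₁ : 3 - 2 * γ < σ) (hσ₂ : σ < 4 - 2 * γ) :
    ∃ C > 0, ∀ (K : ℕ), 1 ≤ K → ∀ (τ : ℝ), τ = T / K →
      ∀ (A : ℝ), 0 ≤ A → ∀ (u u' u'' : ℝ → X),
      ContinuousOn u (Set.Icc 0 T) →
      (∀ t ∈ Set.Ioc (0 : ℝ) T, HasDerivAt u (u' t) t) →
      (∀ t ∈ Set.Ioc (0 : ℝ) T, HasDerivAt u' (u'' t) t) →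
      ContinuousOn u' (Set.Ioc 0 T) →
      ContinuousOn u'' (Set.Ioc 0 T) →
      (∀ t ∈ Set.Ioc (0 : ℝ) T, ‖u' t - t⁻¹ • (u t - u 0)‖ ≤ A * t ^ (γ - 1)) →
      MeasureTheory.IntegrableOn (fun t => t ^ σ * ‖u'' t‖ ^ 2) (Set.Ioc 0 T) →
      (∫ t in Set.Ioc (0 : ℝ) T, t ^ σ * ‖u'' t‖ ^ 2) ≤ A ^ 2 →
      (∀ t ∈ Set.Ioc (0 : ℝ) T, ‖u' t‖ ≤ A * t ^ (γ - 1)) →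
      ∀ (ρ : ℕ → X),
      (∀ k < K, ρ (k + 1) =
          (Real.Gamma (1 - γ))⁻¹ •
              (∫ r in (0 : ℝ)..(((k : ℝ) + 1) * τ),
                ((((k : ℝ) + 1) * τ - r) ^ (-γ)) • u' r)
            - (Real.Gamma (2 - γ) * τ ^ γ)⁻¹ •
                ∑ j ∈ Finset.range (k + 1),
                  (((j : ℝ) + 1) ^ (1 - γ) - (j : ℝ) ^ (1 - γ)) •
                    (u (((k + 1 - j : ℕ) : ℝ) * τ) - u (((k - j : ℕ) : ℝ) * τ))) →
      τ * ∑ k ∈ Finset.Icc 1 K, ‖ρ k‖ ^ 2 ≤ C * τ ^ (4 - 2 * γ - σ) * A ^ 2 ∧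
      Real.sqrt (τ * ∑ k ∈ Finset.Icc 1 K, ‖ρ k‖ ^ 2)
        ≤ Real.sqrt C * τ ^ (2 - γ - σ / 2) * A := by
  obtain ⟨hγ0, hγ1⟩ := hγ
  have hγ' : 0 < 1 - γ := by linarith
  have hG : 0 < Real.Gamma (1 - γ) := Real.Gamma_pos_of_pos hγ'
  set G : ℝ := (Real.Gamma (1 - γ))⁻¹ with hGdef
  have hG0 : 0 < G := inv_pos.2 hG
  set V : ℝ := 1 / (1 - γ) + 1 with hV
  have hV0 : 0 < V := by positivity
  set C : ℝ := G ^ 2 * V ^ 2 * ((3 / γ) ^ 2 * T ^ (σ - 3 + 2 * γ) + 1) with hC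
  have hC0 : 0 < C := by positivity
  refine ⟨C, hC0, ?_⟩
  intro K hK τ hτT A hA u u' u'' hu0 hu hu' hc' hc'' _ hint hle hbd ρ hρ
  have hKR : (0 : ℝ) < K := by exact_mod_cast hK
  have hτ : 0 < τ := by rw [hτT]; positivity
  have hTK : (K : ℝ) * τ = T := by rw [hτT]; field_simp
  have hτ_le : τ ≤ T := by
    rw [← hTK]; exact le_mul_of_one_le_left hτ.le (by exact_mod_cast hK)
  have hnorm : ∀ k ∈ Finset.range K, ‖ρ (k + 1)‖ ^ 2 ≤ (G * τ ^ (1 - γ)) ^ 2 *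
      (∑ i ∈ Finset.range (k + 1),
        consistencyWeight γ (k - i) * stepOscillation γ τ A u'' i) ^ 2 := by
    intro k hk
    have hkK := Finset.mem_range.1 hk
    have hkT : ((k : ℝ) + 1) * τ ≤ T := by
      rw [← hTK]; gcongr; exact_mod_cast hkK
    have hsub : Ioc 0 (((k : ℝ) + 1) * τ) ⊆ Ioc 0 T := Ioc_subset_Ioc_right hkT
    rw [hρ k hkK, residual_eq_sum k hγ0 hγ1 hτ hA (hc'.mono hsub) fun t ht => hbd t (hsub ht),
      ← mul_pow]
    refine pow_le_pow_left₀ (norm_nonneg _) ?_ 2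
    rw [norm_smul, Real.norm_of_nonneg hG0.le, mul_assoc, Finset.mul_sum]
    refine mul_le_mul_of_nonneg_left ((norm_sum_le _ _).trans
      (Finset.sum_le_sum fun i hi => ?_)) hG0.le
    exact norm_integral_smul_sub_slope_le hγ0 hγ1 hτ hA
      (Nat.lt_succ_iff.1 (Finset.mem_range.1 hi)) (hu0.mono (Icc_subset_Icc_right hkT))
      (fun t ht => hu t (hsub ht)) (fun t ht => hu' t (hsub ht)) (hc''.mono hsub)
      (fun t ht => hbd t (hsub ht))
  have hosc := sum_sq_stepOscillation_le (γ := γ) (A := A) (u'' := u'') hτ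
    (by linarith : 0 ≤ σ) hK (by rwa [hTK]) (by rwa [hTK]) (by rwa [hTK])
  have hmain : τ * ∑ k ∈ Finset.Icc 1 K, ‖ρ k‖ ^ 2 ≤ C * τ ^ (4 - 2 * γ - σ) * A ^ 2 := by
    have hshift : ∑ k ∈ Finset.Icc 1 K, ‖ρ k‖ ^ 2 = ∑ k ∈ Finset.range K, ‖ρ (k + 1)‖ ^ 2 := by
      rw [← Finset.Ico_add_one_right_eq_Icc, Finset.sum_Ico_eq_sum_range]
      simp [add_comm]
    rw [hshift]
    have hconv := sum_sq_conv_le (consistencyWeight γ) (stepOscillation γ τ A u'')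
      (consistencyWeight_nonneg hγ0 hγ1) K V (sum_consistencyWeight_le hγ1 K)
    have p1 : τ * (τ ^ (1 - γ)) ^ 2 * (τ ^ (γ - 1)) ^ 2 = τ := by
      rw [mul_assoc, ← mul_pow, ← rpow_add hτ]; simp
    have p2 : τ * (τ ^ (1 - γ)) ^ 2 * (τ * τ ^ (-σ)) = τ ^ (4 - 2 * γ - σ) := by
      have : (4 - 2 * γ - σ) = 1 + (1 - γ) + (1 - γ) + 1 + -σ := by ring
      rw [this]
      simp only [rpow_add hτ, rpow_one]
      ring
    have p3 : τ ≤ T ^ (σ - 3 + 2 * γ) * τ ^ (4 - 2 * γ - σ) := by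
      calc τ = τ ^ (σ - 3 + 2 * γ) * τ ^ (4 - 2 * γ - σ) := by
            rw [← rpow_add hτ]; ring_nf; rw [rpow_one]
        _ ≤ _ := by gcongr; linarith
    calc τ * ∑ k ∈ Finset.range K, ‖ρ (k + 1)‖ ^ 2
        ≤ τ * ((G * τ ^ (1 - γ)) ^ 2 * (V ^ 2 *
            ((3 * A / γ * τ ^ (γ - 1)) ^ 2 + τ * τ ^ (-σ) * A ^ 2))) := by
          refine mul_le_mul_of_nonneg_left ((Finset.sum_le_sum hnorm).trans ?_) hτ.le
          rw [← Finset.mul_sum]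
          exact mul_le_mul_of_nonneg_left
            (hconv.trans (mul_le_mul_of_nonneg_left hosc (sq_nonneg _))) (sq_nonneg _)
      _ = G ^ 2 * V ^ 2 * ((3 / γ) ^ 2 * (τ * (τ ^ (1 - γ)) ^ 2 * (τ ^ (γ - 1)) ^ 2)
            + τ * (τ ^ (1 - γ)) ^ 2 * (τ * τ ^ (-σ))) * A ^ 2 := by ring
      _ = G ^ 2 * V ^ 2 * ((3 / γ) ^ 2 * τ + τ ^ (4 - 2 * γ - σ)) * A ^ 2 := by rw [p1, p2]
      _ ≤ G ^ 2 * V ^ 2 * ((3 / γ) ^ 2 * (T ^ (σ - 3 + 2 * γ) * τ ^ (4 - 2 * γ - σ))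
            + τ ^ (4 - 2 * γ - σ)) * A ^ 2 := by gcongr
      _ = C * τ ^ (4 - 2 * γ - σ) * A ^ 2 := by rw [hC]; ring
  refine ⟨hmain, ?_⟩
  rw [Real.sqrt_le_left (by positivity)]
  refine hmain.trans (le_of_eq ?_)
  have : τ ^ (4 - 2 * γ - σ) = (τ ^ (2 - γ - σ / 2)) ^ 2 := by
    rw [← rpow_mul_natCast hτ.le]; push_cast; ring_nf
  rw [this, mul_pow, mul_pow, Real.sq_sqrt hC0.le]
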